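/- arXiv:math/0601104 — 2 statements merged into one kernel-verified Lean document; each statement's English description precedes it below -/
import Mathlib

section
/- Fix integers a > 0 and b ≥ 0. Let c ∈ {1,2} and let λ, μ be bipartitions of n such that λ^(c') = μ^(c') for the component c' ≠ c, and there exist indices i < j with λ^(c)_i = μ^(c)_i − 1, λ^(c)_j = μ^(c)_j + 1 and λ^(c)_k = μ^(c)_k for all k ∉ {i, j} (so λ^(c) is obtained from μ^(c) by moving one box from row i down to row j). Then a_μ < a_λ. -/
open Finset

/-- `f : ℕ → ℕ` is the 0-indexed part function of a partition: `f i` is the part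
`λ_{i+1}`; the sequence is weakly decreasing and eventually zero. -/
def IsPartitionFun (f : ℕ → ℕ) : Prop := Antitone f ∧ ∃ M, f M = 0

/-- The size `|λ|` of the partition with part function `f`. -/
noncomputable def psize (f : ℕ → ℕ) : ℕ := ∑' i, f i

/-- `α_i = a·(λ^{(1)}_{N+r-i+1} + i - 1) + b'` for `1 ≤ i ≤ N + r`,
where `f` is the 0-indexed part function of `λ^{(1)}`. -/
def alphaE (a b' r N : ℕ) (f : ℕ → ℕ) (i : ℕ) : ℕ := a * (f (N + r - i) + (i - 1)) + b'

/-- `β_j = a·(λ^{(2)}_{N-j+1} + j - 1)` for `1 ≤ j ≤ N`,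
where `g` is the 0-indexed part function of `λ^{(2)}`. -/
def betaE (a N : ℕ) (g : ℕ → ℕ) (j : ℕ) : ℕ := a * (g (N - j) + (j - 1))

/-- `A_N(λ) = Σ_{1≤i≤N+r, 1≤j≤N} min(α_i, β_j) + Σ_{1≤i<j≤N+r} min(α_i, α_j)
    + Σ_{1≤i<j≤N} min(β_i, β_j)`. -/
def AE (a b' r N : ℕ) (f g : ℕ → ℕ) : ℕ :=
  (∑ i ∈ Icc 1 (N + r), ∑ j ∈ Icc 1 N, min (alphaE a b' r N f i) (betaE a N g j)) +
  (∑ i ∈ Icc 1 (N + r), ∑ j ∈ Icc (i + 1) (N + r),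
      min (alphaE a b' r N f i) (alphaE a b' r N f j)) +
  (∑ i ∈ Icc 1 N, ∑ j ∈ Icc (i + 1) N, min (betaE a N g i) (betaE a N g j))

/-- `B_N = Σ_{1≤i≤N+r, 1≤j≤N} min(a(i-1)+b', a(j-1))
    + Σ_{1≤i<j≤N+r} min(a(i-1)+b', a(j-1)+b') + Σ_{1≤i<j≤N} min(a(i-1), a(j-1))`. -/
def BE (a b' r N : ℕ) : ℕ :=
  (∑ i ∈ Icc 1 (N + r), ∑ j ∈ Icc 1 N, min (a * (i - 1) + b') (a * (j - 1))) +
  (∑ i ∈ Icc 1 (N + r), ∑ j ∈ Icc (i + 1) (N + r),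
      min (a * (i - 1) + b') (a * (j - 1) + b')) +
  (∑ i ∈ Icc 1 N, ∑ j ∈ Icc (i + 1) N, min (a * (i - 1)) (a * (j - 1)))

/-- `N` is admissible for the bipartition `(f | g)`:
`λ^{(1)}_{N+r+1} = 0` and `λ^{(2)}_{N+1} = 0`. -/
def AdmissibleN (r N : ℕ) (f g : ℕ → ℕ) : Prop := f (N + r) = 0 ∧ g N = 0

/-- Shifting the summation index of a sum over an interval by one. -/
lemma sum_Icc_shift (F : ℕ → ℕ) (m n : ℕ) :
    ∑ i ∈ Icc (m + 1) (n + 1), F i = ∑ i ∈ Icc m n, F (i + 1) := by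
  rw [← Finset.map_add_right_Icc, Finset.sum_map]
  rfl

lemma sum_Icc_one_succ (F : ℕ → ℕ) (n : ℕ) :
    ∑ i ∈ Icc 1 (n + 1), F i = F 1 + ∑ i ∈ Icc 1 n, F (i + 1) := by
  rw [← sum_Icc_shift, ← Finset.add_sum_Ioc_eq_sum_Icc (by omega)]
  rfl

/-- A symmetric double sum splits into twice its strictly upper triangular part and its
diagonal. -/
lemma sum_Icc_sum_Icc_of_symm (F : ℕ → ℕ → ℕ) (hF : ∀ i j, F i j = F j i) (n : ℕ) :
    ∑ i ∈ Icc 1 n, ∑ j ∈ Icc 1 n, F i j =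
      2 * (∑ i ∈ Icc 1 n, ∑ j ∈ Icc (i + 1) n, F i j) + ∑ i ∈ Icc 1 n, F i i := by
  induction n generalizing F with
  | zero => simp
  | succ n ih =>
    have h := ih (fun i j => F (i + 1) (j + 1)) (fun _ _ => hF _ _)
    simp only [sum_Icc_one_succ]
    simp only [sum_Icc_shift, Finset.sum_add_distrib, h]
    simp only [fun i => hF (i + 1) 1]
    ring

/-- Effect on a triangular sum of minima of shifting all entries by `a` and prepending an entry
`c ≤ a`. -/
lemma sum_min_upper_shift (u u' : ℕ → ℕ) (a c n : ℕ) (hc : c ≤ a) (h1 : u' 1 = c)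
    (hs : ∀ i, 1 ≤ i → u' (i + 1) = u i + a) :
    ∑ i ∈ Icc 1 (n + 1), ∑ j ∈ Icc (i + 1) (n + 1), min (u' i) (u' j) =
      (∑ i ∈ Icc 1 n, ∑ j ∈ Icc (i + 1) n, min (u i) (u j)) +
        (n * c + ∑ i ∈ Icc 1 n, ∑ _j ∈ Icc (i + 1) n, a) := by
  have e1 : ∑ j ∈ Icc 1 n, min (u' 1) (u' (j + 1)) = n * c := by
    rw [Finset.sum_congr rfl (g := fun _ => c)]
    · simp
    · intro j hj
      rw [h1, hs j (Finset.mem_Icc.1 hj).1]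
      omega
  have e2 : ∑ i ∈ Icc 1 n, ∑ j ∈ Icc (i + 1) n, min (u' (i + 1)) (u' (j + 1)) =
      (∑ i ∈ Icc 1 n, ∑ j ∈ Icc (i + 1) n, min (u i) (u j)) +
        ∑ i ∈ Icc 1 n, ∑ _j ∈ Icc (i + 1) n, a := by
    simp only [← Finset.sum_add_distrib]
    refine Finset.sum_congr rfl fun i hi => Finset.sum_congr rfl fun j hj => ?_
    rw [Finset.mem_Icc] at hi hj
    rw [hs i hi.1, hs j (by omega)]
    omega
  simp only [sum_Icc_one_succ]
  simp only [sum_Icc_shift, e1, e2]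
  ring

/-- Effect on a rectangular sum of minima of shifting all entries by `a` and prepending entries
`c ≤ a` and `0`. -/
lemma sum_min_rect_shift (u u' v v' : ℕ → ℕ) (a c m n : ℕ) (hc : c ≤ a) (hu1 : u' 1 = c)
    (hv1 : v' 1 = 0) (hu : ∀ i, 1 ≤ i → u' (i + 1) = u i + a)
    (hv : ∀ i, 1 ≤ i → v' (i + 1) = v i + a) :
    ∑ i ∈ Icc 1 (m + 1), ∑ j ∈ Icc 1 (n + 1), min (u' i) (v' j) =
      (∑ i ∈ Icc 1 m, ∑ j ∈ Icc 1 n, min (u i) (v j)) + (n * c + m * n * a) := by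
  have e1 : ∑ j ∈ Icc 1 n, min (u' 1) (v' (j + 1)) = n * c := by
    rw [Finset.sum_congr rfl (g := fun _ => c)]
    · simp
    · intro j hj
      rw [hu1, hv j (Finset.mem_Icc.1 hj).1]
      omega
  have e2 : ∑ i ∈ Icc 1 m, ∑ j ∈ Icc 1 n, min (u' (i + 1)) (v' (j + 1)) =
      (∑ i ∈ Icc 1 m, ∑ j ∈ Icc 1 n, min (u i) (v j)) + m * n * a := by
    have : m * n * a = ∑ i ∈ Icc 1 m, ∑ _j ∈ Icc 1 n, a := by simp [mul_assoc]
    simp only [this, ← Finset.sum_add_distrib]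
    refine Finset.sum_congr rfl fun i hi => Finset.sum_congr rfl fun j hj => ?_
    rw [hu i (Finset.mem_Icc.1 hi).1, hv j (Finset.mem_Icc.1 hj).1]
    omega
  simp only [sum_Icc_one_succ, Finset.sum_add_distrib, e1, e2, hv1]
  simp
  ring

lemma BE_eq_AE_zero (a b' r N : ℕ) : BE a b' r N = AE a b' r N 0 0 := by
  simp [BE, AE, alphaE, betaE]

/-- Raising `N` by one changes `A_N` by an amount that does not depend on the bipartition. -/
lemma exists_AE_succ_eq (a b' r N : ℕ) (hb' : b' < a) :
    ∃ C, ∀ f g, AdmissibleN r N f g → AE a b' r (N + 1) f g = AE a b' r N f g + C := by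
  refine ⟨(N * b' + (N + r) * N * a) +
    ((N + r) * b' + ∑ i ∈ Icc 1 (N + r), ∑ _j ∈ Icc (i + 1) (N + r), a) +
    (N * 0 + ∑ i ∈ Icc 1 N, ∑ _j ∈ Icc (i + 1) N, a), fun f g h => ?_⟩
  have hN : N + 1 + r = N + r + 1 := by omega
  have hα1 : alphaE a b' r (N + 1) f 1 = b' := by simp [alphaE, hN, h.1]
  have hβ1 : betaE a (N + 1) g 1 = 0 := by simp [betaE, h.2]
  have hα : ∀ i, 1 ≤ i → alphaE a b' r (N + 1) f (i + 1) = alphaE a b' r N f i + a := by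
    intro i hi
    obtain ⟨k, rfl⟩ := Nat.exists_eq_add_of_le' hi
    simp only [alphaE, hN, Nat.add_sub_add_right, Nat.add_sub_cancel]
    ring
  have hβ : ∀ i, 1 ≤ i → betaE a (N + 1) g (i + 1) = betaE a N g i + a := by
    intro i hi
    obtain ⟨k, rfl⟩ := Nat.exists_eq_add_of_le' hi
    simp only [betaE, Nat.add_sub_add_right, Nat.add_sub_cancel]
    ring
  unfold AE
  rw [hN, sum_min_rect_shift _ _ _ _ a b' _ _ hb'.le hα1 hβ1 hα hβ,
    sum_min_upper_shift _ _ a b' _ hb'.le hα1 hα, sum_min_upper_shift _ _ a 0 _ a.zero_le hβ1 hβ]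
  ring

lemma AdmissibleN.mono {r N M : ℕ} {f g : ℕ → ℕ} (hf : IsPartitionFun f) (hg : IsPartitionFun g)
    (h : AdmissibleN r N f g) (hNM : N ≤ M) : AdmissibleN r M f g :=
  ⟨Nat.le_zero.1 (h.1 ▸ hf.1 (by omega)), Nat.le_zero.1 (h.2 ▸ hg.1 hNM)⟩

/-- The difference `A_N - B_N` is the same for all admissible `N`. -/
lemma AE_sub_BE_eq {a b' r N M : ℕ} (hb' : b' < a) {f g : ℕ → ℕ} (hf : IsPartitionFun f)
    (hg : IsPartitionFun g) (h : AdmissibleN r N f g) (hNM : N ≤ M) :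
    (AE a b' r M f g : ℤ) - BE a b' r M = AE a b' r N f g - BE a b' r N := by
  induction M, hNM using Nat.le_induction with
  | base => rfl
  | succ M hM ih =>
    obtain ⟨C, hC⟩ := exists_AE_succ_eq a b' r M hb'
    rw [← ih, BE_eq_AE_zero, BE_eq_AE_zero, hC f g (h.mono hf hg hM), hC 0 0 ⟨rfl, rfl⟩]
    push_cast
    ring

/-- The index set of all entries `α_i`, `β_j`. -/
def entryIdx (r N : ℕ) : Finset (ℕ ⊕ ℕ) := (Icc 1 (N + r)).disjSum (Icc 1 N)

/-- The family of all entries `α_i`, `β_j`. -/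
def entry (a b' r N : ℕ) (f g : ℕ → ℕ) : ℕ ⊕ ℕ → ℕ :=
  Sum.elim (alphaE a b' r N f) (betaE a N g)

lemma sum_sum_min_entry (a b' r N : ℕ) (f g : ℕ → ℕ) :
    ∑ p ∈ entryIdx r N, ∑ q ∈ entryIdx r N,
        min (entry a b' r N f g p) (entry a b' r N f g q) =
      2 * AE a b' r N f g + ∑ p ∈ entryIdx r N, entry a b' r N f g p := by
  simp only [entryIdx, entry, Finset.sum_disjSum, Sum.elim_inl, Sum.elim_inr,
    Finset.sum_add_distrib, AE]
  rw [sum_Icc_sum_Icc_of_symm _ (fun _ _ => min_comm _ _),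
    sum_Icc_sum_Icc_of_symm (fun i j => min (betaE a N g i) (betaE a N g j))
      (fun _ _ => min_comm _ _),
    Finset.sum_comm (s := Icc 1 N) (t := Icc 1 (N + r))]
  simp only [min_self, min_comm (betaE a N g _) (alphaE a b' r N f _)]
  ring

lemma sum_sum_min_insert_insert {ι : Type*} [DecidableEq ι] (s : Finset ι) (z : ι → ℕ) {p q : ι}
    (hpq : p ≠ q) (hp : p ∉ s) (hq : q ∉ s) :
    ∑ k ∈ insert p (insert q s), ∑ l ∈ insert p (insert q s), min (z k) (z l) =
      z p + z q + 2 * min (z p) (z q) + 2 * ∑ k ∈ s, (min (z p) (z k) + min (z q) (z k)) +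
        ∑ k ∈ s, ∑ l ∈ s, min (z k) (z l) := by
  have hp' : p ∉ insert q s := by simp [hpq, hp]
  have hc : ∀ x, ∑ k ∈ s, min (z k) (z x) = ∑ k ∈ s, min (z x) (z k) := fun x =>
    Finset.sum_congr rfl fun _ _ => min_comm _ _
  simp only [Finset.sum_insert hp', Finset.sum_insert hq, Finset.sum_add_distrib, min_self, hc]
  rw [min_comm (z q) (z p)]
  ring

/-- Moving two entries towards each other strictly increases the sum of pairwise minima minus the
sum of the entries. -/
lemma sum_sum_min_lt_of_transfer {ι : Type*} [DecidableEq ι] (s : Finset ι) (z z' : ι → ℕ)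
    {p q : ι} {d : ℕ} (hd : 0 < d) (hps : p ∈ s) (hqs : q ∈ s) (hp : z p = z' p + d)
    (hq : z' q = z q + d) (hle : z' q ≤ z' p) (hk : ∀ k ∈ s, k ≠ p → k ≠ q → z' k = z k) :
    (∑ k ∈ s, ∑ l ∈ s, min (z k) (z l)) + ∑ k ∈ s, z' k <
      (∑ k ∈ s, ∑ l ∈ s, min (z' k) (z' l)) + ∑ k ∈ s, z k := by
  have hpq : p ≠ q := by rintro rfl; omega
  obtain ⟨t, hpt, hqt, rfl⟩ : ∃ t, p ∉ t ∧ q ∉ t ∧ s = insert p (insert q t) :=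
    ⟨(s.erase p).erase q, by simp, by simp, by
      rw [Finset.insert_erase (by simp [hqs, hpq.symm]), Finset.insert_erase hps]⟩
  have hkt : ∀ k ∈ t, z' k = z k := fun k h =>
    hk k (by simp [h]) (fun e => hpt (e ▸ h)) (fun e => hqt (e ▸ h))
  have hp' : p ∉ insert q t := by simp [hpq, hpt]
  rw [sum_sum_min_insert_insert t z hpq hpt hqt, sum_sum_min_insert_insert t z' hpq hpt hqt,
    Finset.sum_insert hp', Finset.sum_insert hp', Finset.sum_insert hqt, Finset.sum_insert hqt]
  have e0 : ∑ k ∈ t, z' k = ∑ k ∈ t, z k := Finset.sum_congr rfl hkt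
  have e : ∑ k ∈ t, ∑ l ∈ t, min (z' k) (z' l) = ∑ k ∈ t, ∑ l ∈ t, min (z k) (z l) :=
    Finset.sum_congr rfl fun k h => Finset.sum_congr rfl fun l h' => by rw [hkt k h, hkt l h']
  have h : ∑ k ∈ t, (min (z p) (z k) + min (z q) (z k)) ≤
      ∑ k ∈ t, (min (z' p) (z' k) + min (z' q) (z' k)) := by
    refine Finset.sum_le_sum fun k h => ?_
    rw [hkt k h]
    omega
  omega

lemma AE_lt_of_entry_transfer {a b' r N : ℕ} (ha : 0 < a) {f g f' g' : ℕ → ℕ} {p q : ℕ ⊕ ℕ}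
    (hps : p ∈ entryIdx r N) (hqs : q ∈ entryIdx r N)
    (hp : entry a b' r N f g p = entry a b' r N f' g' p + a)
    (hq : entry a b' r N f' g' q = entry a b' r N f g q + a)
    (hle : entry a b' r N f' g' q ≤ entry a b' r N f' g' p)
    (hk : ∀ k ∈ entryIdx r N, k ≠ p → k ≠ q →
      entry a b' r N f' g' k = entry a b' r N f g k) :
    AE a b' r N f g < AE a b' r N f' g' := by
  have h := sum_sum_min_lt_of_transfer _ _ _ ha hps hqs hp hq hle hk
  rw [sum_sum_min_entry, sum_sum_min_entry] at h
  omega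

/-- Moving a box down in the first component strictly increases `A_N`. -/
lemma AE_lt_of_move_fst {a b' r N : ℕ} (ha : 0 < a) {f f' g : ℕ → ℕ} (hf' : Antitone f')
    (hN : f' (N + r) = 0) {i j : ℕ} (hij : i < j) (hi : f i = f' i + 1) (hj : f' j = f j + 1)
    (hk : ∀ k, k ≠ i → k ≠ j → f' k = f k) :
    AE a b' r N f g < AE a b' r N f' g := by
  have hjN : j < N + r := by
    by_contra! h
    have := hf' h
    omega
  have ei : N + r - (N + r - i) = i := by omega
  have ej : N + r - (N + r - j) = j := by omega
  refine AE_lt_of_entry_transfer ha (p := Sum.inl (N + r - i)) (q := Sum.inl (N + r - j))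
    ?_ ?_ ?_ ?_ ?_ ?_
  · simp [entryIdx]; omega
  · simp [entryIdx]; omega
  · simp only [entry, Sum.elim_inl, alphaE, ei, hi]; ring
  · simp only [entry, Sum.elim_inl, alphaE, ej, hj]; ring
  · simp only [entry, Sum.elim_inl, alphaE, ei, ej]
    have := hf' hij.le
    gcongr
  · rintro (k | k) hks hki hkj
    · simp only [entryIdx, Finset.inl_mem_disjSum, Finset.mem_Icc, ne_eq, Sum.inl.injEq]
        at hks hki hkj
      simp only [entry, Sum.elim_inl, alphaE, hk (N + r - k) (by omega) (by omega)]
    · rfl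

/-- Moving a box down in the second component strictly increases `A_N`. -/
lemma AE_lt_of_move_snd {a b' r N : ℕ} (ha : 0 < a) {f g g' : ℕ → ℕ} (hg' : Antitone g')
    (hN : g' N = 0) {i j : ℕ} (hij : i < j) (hi : g i = g' i + 1) (hj : g' j = g j + 1)
    (hk : ∀ k, k ≠ i → k ≠ j → g' k = g k) :
    AE a b' r N f g < AE a b' r N f g' := by
  have hjN : j < N := by
    by_contra! h
    have := hg' h
    omega
  have ei : N - (N - i) = i := by omega
  have ej : N - (N - j) = j := by omega
  refine AE_lt_of_entry_transfer ha (p := Sum.inr (N - i)) (q := Sum.inr (N - j))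
    ?_ ?_ ?_ ?_ ?_ ?_
  · simp [entryIdx]; omega
  · simp [entryIdx]; omega
  · simp only [entry, Sum.elim_inr, betaE, ei, hi]; ring
  · simp only [entry, Sum.elim_inr, betaE, ej, hj]; ring
  · simp only [entry, Sum.elim_inr, betaE, ei, ej]
    have := hg' hij.le
    gcongr
  · rintro (k | k) hks hki hkj
    · rfl
    · simp only [entryIdx, Finset.inr_mem_disjSum, Finset.mem_Icc, ne_eq, Sum.inr.injEq]
        at hks hki hkj
      simp only [entry, Sum.elim_inr, betaE, hk (N - k) (by omega) (by omega)]

/-- Let `λ, μ` be bipartitions of `n` (components indexed by `Fin 2`, with `0`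
corresponding to the first component) agreeing in the component `c' ≠ c`, and suppose
that in component `c` there are rows `i < j` (0-indexed) with `λ^{(c)}_i = μ^{(c)}_i - 1`,
`λ^{(c)}_j = μ^{(c)}_j + 1` and `λ^{(c)}_k = μ^{(c)}_k` otherwise (so `λ^{(c)}` is
obtained from `μ^{(c)}` by moving one box from row `i` down to row `j`).
Then `a_μ < a_λ`. -/
theorem lusztig_a_invariant_box_move
    (n a b r b' : ℕ) (ha : 0 < a) (hb : b = a * r + b') (hb' : b' < a)
    (lam mu : Fin 2 → ℕ → ℕ)
    (hlam : ∀ c, IsPartitionFun (lam c)) (hmu : ∀ c, IsPartitionFun (mu c))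
    (hnl : psize (lam 0) + psize (lam 1) = n)
    (hnm : psize (mu 0) + psize (mu 1) = n)
    (c : Fin 2) (hother : ∀ c', c' ≠ c → lam c' = mu c')
    (i j : ℕ) (hij : i < j)
    (hi : mu c i = lam c i + 1)
    (hj : lam c j = mu c j + 1)
    (hk : ∀ k, k ≠ i → k ≠ j → lam c k = mu c k) :
    ∀ N N' : ℕ, AdmissibleN r N (mu 0) (mu 1) → AdmissibleN r N' (lam 0) (lam 1) →
      (AE a b' r N (mu 0) (mu 1) : ℤ) - (BE a b' r N : ℤ) <
        (AE a b' r N' (lam 0) (lam 1) : ℤ) - (BE a b' r N' : ℤ) := by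
  intro N N' hN hN'
  rw [← AE_sub_BE_eq hb' (hmu 0) (hmu 1) hN (le_max_left N N'),
    ← AE_sub_BE_eq hb' (hlam 0) (hlam 1) hN' (le_max_right N N')]
  have hM := hN'.mono (hlam 0) (hlam 1) (le_max_right N N')
  refine sub_lt_sub_right (Nat.cast_lt.2 ?_) _
  obtain rfl | rfl : c = 0 ∨ c = 1 := by omega
  · rw [← hother 1 (by decide)]
    exact AE_lt_of_move_fst ha (hlam 0).1 hM.1 hij hi hj hk
  · rw [← hother 0 (by decide)]
    exact AE_lt_of_move_snd ha (hlam 1).1 hM.2 hij hi hj hk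
end

section
/- Fix integers a, b with b > (n−1)a > 0. Let λ and μ be bipartitions of n with |λ^(1)| = |μ^(1)|, |λ^(2)| = |μ^(2)|, λ^(1) ⊴ μ^(1) and λ^(2) ⊴ μ^(2) (dominance of partitions). Then a_μ ≤ a_λ, with equality only if λ = μ, where a_λ := b·|λ^(2)| + a·(n(λ^(1)) + 2·n(λ^(2)) − n(λ^(2)*)). -/
open Finset

/-- `n(ν) = Σ_{i≥1} (i-1)·ν_i` for the partition with 0-indexed part function `f`. -/
noncomputable def nFn (f : ℕ → ℕ) : ℕ := ∑' i, i * f i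

/-- The 0-indexed part function of the conjugate partition: `ν*_{i+1} = #{j : ν_j ≥ i+1}`. -/
noncomputable def conjFn (f : ℕ → ℕ) (i : ℕ) : ℕ := Set.ncard {j : ℕ | i + 1 ≤ f j}

/-- The closed formula for Lusztig's `a`-invariant of the bipartition `(f | g)` when
`b > (n-1)·a > 0`:  `a_λ = b·|λ^{(2)}| + a·(n(λ^{(1)}) + 2·n(λ^{(2)}) - n(λ^{(2)*}))`. -/
noncomputable def aInv (a b : ℕ) (f g : ℕ → ℕ) : ℤ :=
  (b : ℤ) * (psize g : ℤ) +
    (a : ℤ) * ((nFn f : ℤ) + 2 * (nFn g : ℤ) - (nFn (conjFn g) : ℤ))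

/-- Dominance order on partitions (0-indexed part functions):
`f ⊴ f'` iff `Σ_{i≤j} f_i ≤ Σ_{i≤j} f'_i` for all `j`. -/
def DominatedBy (f f' : ℕ → ℕ) : Prop :=
  ∀ m : ℕ, ∑ i ∈ range m, f i ≤ ∑ i ∈ range m, f' i

theorem IsPartitionFun.exists_forall_ge {f : ℕ → ℕ} (hf : IsPartitionFun f) :
    ∃ M, ∀ i, M ≤ i → f i = 0 := by
  obtain ⟨hanti, M, hM⟩ := hf
  exact ⟨M, fun i hi => Nat.eq_zero_of_le_zero (hM ▸ hanti hi)⟩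

theorem psize_eq_sum_range {f : ℕ → ℕ} {M : ℕ} (hM : ∀ i, M ≤ i → f i = 0) :
    psize f = ∑ i ∈ range M, f i :=
  tsum_eq_sum fun i hi => hM i (by simpa using hi)

theorem nFn_eq_sum_range {f : ℕ → ℕ} {M : ℕ} (hM : ∀ i, M ≤ i → f i = 0) :
    nFn f = ∑ i ∈ range M, i * f i :=
  tsum_eq_sum fun i hi => by simp [hM i (by simpa using hi)]

theorem conjFn_eq_sum_range {g : ℕ → ℕ} {M : ℕ} (hM : ∀ i, M ≤ i → g i = 0) (i : ℕ) :
    conjFn g i = ∑ j ∈ range M, if i < g j then 1 else 0 := by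
  have hset : {j : ℕ | i + 1 ≤ g j} = ((range M).filter fun j => i < g j : Finset ℕ) := by
    ext j
    have := hM j
    simp only [Set.mem_ofPred_eq, coe_filter, mem_range]
    omega
  rw [conjFn, hset, Set.ncard_coe_finset, card_filter]

/-- `n(ν*) = Σ_j ν_j(ν_j - 1)/2`. -/
theorem two_mul_nFn_conjFn {g : ℕ → ℕ} {M : ℕ} (hg : Antitone g)
    (hM : ∀ i, M ≤ i → g i = 0) :
    2 * (nFn (conjFn g) : ℤ) = ∑ j ∈ range M, ((g j : ℤ) * g j - g j) := by
  have hconj : ∀ i, g 0 ≤ i → conjFn g i = 0 := by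
    intro i hi
    rw [conjFn_eq_sum_range hM]
    exact sum_eq_zero fun j _ => if_neg (not_lt.2 ((hg (Nat.zero_le j)).trans hi))
  have hsum : nFn (conjFn g) = ∑ j ∈ range M, ∑ i ∈ range (g j), i := by
    rw [nFn_eq_sum_range hconj]
    simp_rw [conjFn_eq_sum_range hM, mul_sum]
    rw [sum_comm]
    refine sum_congr rfl fun j _ => ?_
    simp_rw [mul_ite, mul_one, mul_zero]
    rw [← sum_filter]
    refine sum_congr ?_ fun _ _ => rfl
    ext i
    have := hg (Nat.zero_le j)
    simp only [mem_filter, mem_range]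
    omega
  rw [hsum]
  push_cast
  rw [mul_sum]
  refine sum_congr rfl fun j _ => ?_
  generalize g j = k
  induction k with
  | zero => simp
  | succ k ih =>
    rw [sum_range_succ, mul_add, ih]
    push_cast
    ring

theorem sum_range_mul_eq_by_parts (w d : ℕ → ℤ) (M : ℕ) :
    ∑ i ∈ range M, w i * d i =
      w M * ∑ i ∈ range M, d i +
        ∑ i ∈ range M, (w i - w (i + 1)) * ∑ j ∈ range (i + 1), d j := by
  induction M with
  | zero => simp
  | succ M ih =>
    rw [sum_range_succ, ih, sum_range_succ (fun i => (w i - w (i + 1)) * _), sum_range_succ d M]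
    ring

theorem DominatedBy.sum_range_sub_nonneg {f f' : ℕ → ℕ} (h : DominatedBy f f') (m : ℕ) :
    0 ≤ ∑ i ∈ range m, ((f' i : ℤ) - f i) := by
  rw [sum_sub_distrib, sub_nonneg]
  exact_mod_cast h m

theorem IsPartitionFun.exists_forall_ge_and_sum_sub_eq_zero {f f' : ℕ → ℕ}
    (hf : IsPartitionFun f) (hf' : IsPartitionFun f') (hs : psize f = psize f') :
    ∃ M, (∀ i, M ≤ i → f i = 0) ∧ (∀ i, M ≤ i → f' i = 0) ∧
      ∑ i ∈ range M, ((f' i : ℤ) - f i) = 0 := by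
  obtain ⟨A, hA⟩ := hf.exists_forall_ge
  obtain ⟨B, hB⟩ := hf'.exists_forall_ge
  have hA' : ∀ i, max A B ≤ i → f i = 0 := fun i hi => hA i (le_of_max_le_left hi)
  have hB' : ∀ i, max A B ≤ i → f' i = 0 := fun i hi => hB i (le_of_max_le_right hi)
  refine ⟨max A B, hA', hB', ?_⟩
  rw [psize_eq_sum_range hA', psize_eq_sum_range hB'] at hs
  rw [sum_sub_distrib, sub_eq_zero]
  exact_mod_cast hs.symm

/-- `ν ↦ n(ν)` is strictly decreasing for the dominance order. -/
theorem DominatedBy.nFn_le {f f' : ℕ → ℕ} (h : DominatedBy f f')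
    (hf : IsPartitionFun f) (hf' : IsPartitionFun f') (hs : psize f = psize f') :
    nFn f' ≤ nFn f ∧ (nFn f' = nFn f → f = f') := by
  obtain ⟨M, hM, hM', hzero⟩ := hf.exists_forall_ge_and_sum_sub_eq_zero hf' hs
  have hdiff : (nFn f : ℤ) - nFn f' =
      ∑ i ∈ range M, ∑ j ∈ range (i + 1), ((f' j : ℤ) - f j) := by
    have hparts := sum_range_mul_eq_by_parts (fun i => (i : ℤ)) (fun i => (f' i : ℤ) - f i) M
    simp only [hzero, mul_zero, zero_add, Nat.cast_add, Nat.cast_one, sub_add_cancel_left,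
      neg_one_mul, sum_neg_distrib, mul_sub] at hparts
    rw [sum_sub_distrib] at hparts
    rw [nFn_eq_sum_range hM, nFn_eq_sum_range hM']
    push_cast
    linarith
  have hnonneg : ∀ i ∈ range M, 0 ≤ ∑ j ∈ range (i + 1), ((f' j : ℤ) - f j) :=
    fun i _ => h.sum_range_sub_nonneg (i + 1)
  refine ⟨by have := sum_nonneg hnonneg; omega, fun heq => ?_⟩
  rw [heq, sub_self] at hdiff
  have hpartial : ∀ m ≤ M, ∑ j ∈ range m, ((f' j : ℤ) - f j) = 0 := by
    rintro (_ | m) hm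
    · simp
    · exact (sum_eq_zero_iff_of_nonneg hnonneg).1 hdiff.symm m (mem_range.2 hm)
  funext i
  rcases le_or_gt M i with hi | hi
  · rw [hM i hi, hM' i hi]
  · have hsucc := hpartial (i + 1) hi
    rw [sum_range_succ, hpartial i hi.le] at hsucc
    omega

theorem DominatedBy.nFn_conjFn_le {g g' : ℕ → ℕ} (h : DominatedBy g g')
    (hg : IsPartitionFun g) (hg' : IsPartitionFun g') (hs : psize g = psize g') :
    nFn (conjFn g) ≤ nFn (conjFn g') := by
  obtain ⟨M, hM, hM', hzero⟩ := hg.exists_forall_ge_and_sum_sub_eq_zero hg' hs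
  have hparts := sum_range_mul_eq_by_parts (fun i => (g' i : ℤ) + g i - 1)
    (fun i => (g' i : ℤ) - g i) M
  have hnonneg : 0 ≤ ∑ i ∈ range M, ((g' i : ℤ) + g i - 1) * ((g' i : ℤ) - g i) := by
    rw [hparts, hzero, mul_zero, zero_add]
    refine sum_nonneg fun i _ => mul_nonneg ?_ (h.sum_range_sub_nonneg _)
    have h₁ := hg.1 (Nat.le_succ i)
    have h₂ := hg'.1 (Nat.le_succ i)
    simp only [Nat.succ_eq_add_one] at h₁ h₂
    omega
  have hdiff : 2 * (nFn (conjFn g') : ℤ) - 2 * nFn (conjFn g) =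
      ∑ i ∈ range M, ((g' i : ℤ) + g i - 1) * ((g' i : ℤ) - g i) := by
    rw [two_mul_nFn_conjFn hg.1 hM, two_mul_nFn_conjFn hg'.1 hM', ← sum_sub_distrib]
    exact sum_congr rfl fun i _ => by ring
  omega

/-- Fix `b > (n-1)·a > 0`.  If `λ = (f₁|g₁)` and `μ = (f₂|g₂)` are bipartitions of `n`
with `|λ^{(1)}| = |μ^{(1)}|`, `|λ^{(2)}| = |μ^{(2)}|`, `λ^{(1)} ⊴ μ^{(1)}` and
`λ^{(2)} ⊴ μ^{(2)}`, then `a_μ ≤ a_λ`, with equality only if `λ = μ`. -/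
theorem a_invariant_componentwise_dominance_closed_formula
    (n a b : ℕ) (hna : 0 < (n - 1) * a) (hab : (n - 1) * a < b)
    (f₁ g₁ f₂ g₂ : ℕ → ℕ)
    (hf₁ : IsPartitionFun f₁) (hg₁ : IsPartitionFun g₁)
    (hf₂ : IsPartitionFun f₂) (hg₂ : IsPartitionFun g₂)
    (hn₁ : psize f₁ + psize g₁ = n) (hn₂ : psize f₂ + psize g₂ = n)
    (hs₁ : psize f₁ = psize f₂) (hs₂ : psize g₁ = psize g₂)
    (hd₁ : DominatedBy f₁ f₂) (hd₂ : DominatedBy g₁ g₂) :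
    aInv a b f₂ g₂ ≤ aInv a b f₁ g₁ ∧
      (aInv a b f₂ g₂ = aInv a b f₁ g₁ → f₁ = f₂ ∧ g₁ = g₂) := by
  have ha : (0 : ℤ) < a := by exact_mod_cast Nat.pos_of_mul_pos_left hna
  obtain ⟨hf, hf_eq⟩ := hd₁.nFn_le hf₁ hf₂ hs₁
  obtain ⟨hg, hg_eq⟩ := hd₂.nFn_le hg₁ hg₂ hs₂
  have hconj := hd₂.nFn_conjFn_le hg₁ hg₂ hs₂
  simp only [aInv, hs₂, add_le_add_iff_left, add_right_inj]
  refine ⟨mul_le_mul_of_nonneg_left (by omega) ha.le, fun heq => ?_⟩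
  have := mul_left_cancel₀ ha.ne' heq
  exact ⟨hf_eq (by omega), hg_eq (by omega)⟩
end
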